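/- Suppose σ̄ ≥ 1 is compatible with the inner partition (‖By‖² ≤ σ̄ Σ_{ℓ=1}^L ‖B y_[ℓ]‖² for all y ∈ ℝ^m), and suppose c_A > 0 satisfies both Σ_{ℓ=1}^L ‖B y_[ℓ]‖² ≤ c_A ‖y‖² and ‖B y‖² ≥ c_A ‖y‖² for all y ∈ ℝ^m. Assume G attains its minimum value G* at some d* ∈ ℝ^m. Fix d ∈ ℝ^m and θ̄ ∈ (0,1], and let Δ_[ℓ] be a θ̄-approximate solution of subtask ℓ at d for each ℓ = 1,…,L. Then one inner CoCoA round contracts the local suboptimality: G(d + Σ_{ℓ=1}^L Δ_[ℓ]) − G* ≤ (1 − (1−θ̄)·(q c_A + μ)/(σ̄ q c_A + μ))·(G(d) − G*). -/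

import Mathlib

open RealInnerProductSpace Finset

noncomputable section

/-- Matrix–vector product `B y` viewed as a map between Euclidean spaces. -/
def mulVecE {d m : ℕ} (B : Matrix (Fin d) (Fin m) ℝ) (y : EuclideanSpace ℝ (Fin m)) :
    EuclideanSpace ℝ (Fin d) :=
  (WithLp.equiv 2 _).symm (B.mulVec ((WithLp.equiv 2 _) y))

/-- `restr J y` (written `y_[ℓ]` in the paper) equals `y` on the coordinates in `J`
and is zero elsewhere. -/
def restr {m : ℕ} (J : Finset (Fin m)) (y : EuclideanSpace ℝ (Fin m)) :
    EuclideanSpace ℝ (Fin m) :=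
  (WithLp.equiv 2 _).symm (fun i => if i ∈ J then y i else 0)

/-- The local objective `G(d) = c₀ + ⟨w, Bd⟩ + (q/2)‖Bd‖² + ∑ i ḡ i (d i)`. -/
def objG {d m : ℕ} (B : Matrix (Fin d) (Fin m) ℝ) (c₀ : ℝ)
    (w : EuclideanSpace ℝ (Fin d)) (q : ℝ) (gbar : Fin m → ℝ → ℝ)
    (x : EuclideanSpace ℝ (Fin m)) : ℝ :=
  c₀ + ⟪w, mulVecE B x⟫ + q / 2 * ‖mulVecE B x‖ ^ 2 + ∑ i, gbar i (x i)

/-- The inner subtask objective of unit `ℓ`: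
`G_σ̄^{(ℓ)}(Δ; d) = (1/L)[c₀ + ⟨w, v̄⟩ + (q/2)‖v̄‖²] + ⟨w + q v̄, BΔ⟩ + (σ̄q/2)‖BΔ‖²
  + ∑_{i ∈ J_ℓ} ḡ i (d i + Δ i)`, where `v̄ = Bd`. -/
def locG {d m : ℕ} (B : Matrix (Fin d) (Fin m) ℝ) (c₀ : ℝ)
    (w : EuclideanSpace ℝ (Fin d)) (q : ℝ) (gbar : Fin m → ℝ → ℝ)
    (L : ℕ) (σb : ℝ) (Jl : Finset (Fin m))
    (x Δ : EuclideanSpace ℝ (Fin m)) : ℝ :=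
  (1 / (L : ℝ)) * (c₀ + ⟪w, mulVecE B x⟫ + q / 2 * ‖mulVecE B x‖ ^ 2)
    + ⟪w + q • mulVecE B x, mulVecE B Δ⟫ + σb * q / 2 * ‖mulVecE B Δ‖ ^ 2
    + ∑ i ∈ Jl, gbar i (x i + Δ i)

/-- Infimum of the subtask objective of unit `ℓ` over vectors supported on `Jl`. -/
def locGInf {d m : ℕ} (B : Matrix (Fin d) (Fin m) ℝ) (c₀ : ℝ)
    (w : EuclideanSpace ℝ (Fin d)) (q : ℝ) (gbar : Fin m → ℝ → ℝ)
    (L : ℕ) (σb : ℝ) (Jl : Finset (Fin m)) (x : EuclideanSpace ℝ (Fin m)) : ℝ :=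
  sInf ((locG B c₀ w q gbar L σb Jl x) '' {Δ | ∀ i ∉ Jl, Δ i = 0})

/-- `Δl` is a θ̄-approximate solution of subtask `ℓ` at `x`. -/
def IsApproxG {d m : ℕ} (B : Matrix (Fin d) (Fin m) ℝ) (c₀ : ℝ)
    (w : EuclideanSpace ℝ (Fin d)) (q : ℝ) (gbar : Fin m → ℝ → ℝ)
    (L : ℕ) (σb θb : ℝ) (Jl : Finset (Fin m))
    (x Δl : EuclideanSpace ℝ (Fin m)) : Prop :=
  (∀ i ∉ Jl, Δl i = 0) ∧
    locG B c₀ w q gbar L σb Jl x Δl - locGInf B c₀ w q gbar L σb Jl x ≤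
      θb * (locG B c₀ w q gbar L σb Jl x 0 - locGInf B c₀ w q gbar L σb Jl x)

theorem mulVecE_add {d m : ℕ} (B : Matrix (Fin d) (Fin m) ℝ) (y z : EuclideanSpace ℝ (Fin m)) :
    mulVecE B (y + z) = mulVecE B y + mulVecE B z := by
  ext i
  simp [mulVecE, Matrix.mulVec_add]

theorem mulVecE_smul {d m : ℕ} (B : Matrix (Fin d) (Fin m) ℝ) (s : ℝ)
    (y : EuclideanSpace ℝ (Fin m)) :
    mulVecE B (s • y) = s • mulVecE B y := by
  ext i
  simp [mulVecE, Matrix.mulVec_smul]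

theorem mulVecE_zero {d m : ℕ} (B : Matrix (Fin d) (Fin m) ℝ) : mulVecE B 0 = 0 := by
  ext i
  simp [mulVecE]

theorem mulVecE_sum {d m : ℕ} {ι : Type*} (B : Matrix (Fin d) (Fin m) ℝ) (s : Finset ι)
    (y : ι → EuclideanSpace ℝ (Fin m)) :
    mulVecE B (∑ l ∈ s, y l) = ∑ l ∈ s, mulVecE B (y l) :=
  map_sum (AddMonoidHom.mk' (mulVecE B) (mulVecE_add B)) y s

@[simp]
theorem restr_apply {m : ℕ} (J : Finset (Fin m)) (y : EuclideanSpace ℝ (Fin m)) (i : Fin m) :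
    restr J y i = if i ∈ J then y i else 0 := rfl

theorem restr_smul {m : ℕ} (J : Finset (Fin m)) (s : ℝ) (y : EuclideanSpace ℝ (Fin m)) :
    restr J (s • y) = s • restr J y := by
  ext i
  simp

theorem sum_sum_partition {m L : ℕ} {J : Fin L → Finset (Fin m)}
    (hdisj : ∀ l l', l ≠ l' → Disjoint (J l) (J l')) (hcover : ∀ i, ∃ l, i ∈ J l)
    (f : Fin m → ℝ) : ∑ l, ∑ i ∈ J l, f i = ∑ i, f i := by
  rw [← Finset.sum_biUnion fun l _ l' _ h => hdisj l l' h]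
  congr 1
  ext i
  simpa using hcover i

theorem sum_restr {m L : ℕ} {J : Fin L → Finset (Fin m)}
    (hdisj : ∀ l l', l ≠ l' → Disjoint (J l) (J l')) (hcover : ∀ i, ∃ l, i ∈ J l)
    (y : EuclideanSpace ℝ (Fin m)) : ∑ l, restr (J l) y = y := by
  ext i
  obtain ⟨k, hk⟩ := hcover i
  rw [WithLp.ofLp_sum, Finset.sum_apply, Finset.sum_eq_single k]
  · simp [hk]
  · intro l _ hl
    simp [Finset.disjoint_right.mp (hdisj l k hl) hk]
  · simp

theorem restr_sum_eq {m L : ℕ} {J : Fin L → Finset (Fin m)}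
    (hdisj : ∀ l l', l ≠ l' → Disjoint (J l) (J l'))
    {y : Fin L → EuclideanSpace ℝ (Fin m)} (hy : ∀ l, ∀ i ∉ J l, y l i = 0) (k : Fin L) :
    restr (J k) (∑ l, y l) = y k := by
  ext i
  rw [restr_apply]
  split_ifs with hi
  · rw [WithLp.ofLp_sum, Finset.sum_apply, Finset.sum_eq_single k]
    · intro l _ hl
      exact hy l i (Finset.disjoint_right.mp (hdisj l k hl) hi)
    · simp
  · exact (hy k i hi).symm

/-- Second-order expansion of the local objective around `x`. -/
theorem objG_add {d m : ℕ} (B : Matrix (Fin d) (Fin m) ℝ) (c₀ : ℝ)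
    (w : EuclideanSpace ℝ (Fin d)) (q : ℝ) (gbar : Fin m → ℝ → ℝ)
    (x y : EuclideanSpace ℝ (Fin m)) :
    objG B c₀ w q gbar (x + y) =
      (c₀ + ⟪w, mulVecE B x⟫ + q / 2 * ‖mulVecE B x‖ ^ 2)
        + ⟪w + q • mulVecE B x, mulVecE B y⟫ + q / 2 * ‖mulVecE B y‖ ^ 2
        + ∑ i, gbar i (x i + y i) := by
  simp only [objG, mulVecE_add, norm_add_sq_real, inner_add_right, inner_add_left,
    real_inner_smul_left, PiLp.add_apply]
  ring

/-- The subtask objectives, evaluated at the blocks of `y`, add up to a quadratic model of `G`. -/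
theorem sum_locG_restr {d m L : ℕ} (B : Matrix (Fin d) (Fin m) ℝ) (c₀ : ℝ)
    (w : EuclideanSpace ℝ (Fin d)) (q : ℝ) (gbar : Fin m → ℝ → ℝ) (hL : L ≠ 0)
    {J : Fin L → Finset (Fin m)} (hdisj : ∀ l l', l ≠ l' → Disjoint (J l) (J l'))
    (hcover : ∀ i, ∃ l, i ∈ J l) (σb : ℝ) (x y : EuclideanSpace ℝ (Fin m)) :
    ∑ l, locG B c₀ w q gbar L σb (J l) x (restr (J l) y) =
      (c₀ + ⟪w, mulVecE B x⟫ + q / 2 * ‖mulVecE B x‖ ^ 2)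
        + ⟪w + q • mulVecE B x, mulVecE B y⟫
        + σb * q / 2 * ∑ l, ‖mulVecE B (restr (J l) y)‖ ^ 2
        + ∑ i, gbar i (x i + y i) := by
  have hL' : (L : ℝ) ≠ 0 := by exact_mod_cast hL
  have hg : ∀ l, ∑ i ∈ J l, gbar i (x i + restr (J l) y i) = ∑ i ∈ J l, gbar i (x i + y i) :=
    fun l => Finset.sum_congr rfl fun i hi => by simp [hi]
  have hB : ∑ l, ⟪w + q • mulVecE B x, mulVecE B (restr (J l) y)⟫
      = ⟪w + q • mulVecE B x, mulVecE B y⟫ := by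
    rw [← inner_sum, ← mulVecE_sum, sum_restr hdisj hcover]
  simp only [locG, hg, Finset.sum_add_distrib, hB, ← Finset.mul_sum,
    sum_sum_partition hdisj hcover fun i => gbar i (x i + y i)]
  simp only [Finset.sum_const, Finset.card_univ, Fintype.card_fin, nsmul_eq_mul]
  field_simp

/-- A lower bound for `G` bounds every subtask objective from below. -/
theorem bddBelow_locG {d m : ℕ} (B : Matrix (Fin d) (Fin m) ℝ) (c₀ : ℝ)
    (w : EuclideanSpace ℝ (Fin d)) {q : ℝ} (hq : 0 ≤ q) (gbar : Fin m → ℝ → ℝ) (L : ℕ)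
    {σb : ℝ} (hσb : 1 ≤ σb) (Jl : Finset (Fin m)) {a : ℝ}
    (ha : ∀ y, a ≤ objG B c₀ w q gbar y) (x : EuclideanSpace ℝ (Fin m)) :
    BddBelow (locG B c₀ w q gbar L σb Jl x '' {Δ | ∀ i ∉ Jl, Δ i = 0}) := by
  set P := c₀ + ⟪w, mulVecE B x⟫ + q / 2 * ‖mulVecE B x‖ ^ 2 with hP
  refine ⟨a - P - ∑ i ∈ Jlᶜ, gbar i (x i) + 1 / (L : ℝ) * P, ?_⟩
  rintro _ ⟨y, hy, rfl⟩
  have h := ha (x + y)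
  rw [objG_add, ← hP, ← Finset.sum_add_sum_compl Jl fun i => gbar i (x i + y i),
    Finset.sum_congr rfl fun i (hi : i ∈ Jlᶜ) => by
      rw [hy i (Finset.mem_compl.mp hi), add_zero]] at h
  have hσ : q / 2 * ‖mulVecE B y‖ ^ 2 ≤ σb * q / 2 * ‖mulVecE B y‖ ^ 2 := by
    gcongr
    nlinarith
  rw [locG, ← hP]
  linarith

/-- The quadratic model along the segment from `x` to `z`, with step
`s = (q cA + μ) / (σb q cA + μ)`, lies below the interpolation of `G`. -/
theorem sum_locG_segment_le {d m L : ℕ} (B : Matrix (Fin d) (Fin m) ℝ) (c₀ : ℝ)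
    (w : EuclideanSpace ℝ (Fin d)) {q : ℝ} (hq : 0 ≤ q) (gbar : Fin m → ℝ → ℝ) {μ : ℝ}
    (hgbar : ∀ i, StrongConvexOn Set.univ μ (gbar i)) (hL : L ≠ 0)
    {J : Fin L → Finset (Fin m)} (hdisj : ∀ l l', l ≠ l' → Disjoint (J l) (J l'))
    (hcover : ∀ i, ∃ l, i ∈ J l) {σb : ℝ} (hσb : 0 ≤ σb) {cA : ℝ}
    (hupper : ∀ y : EuclideanSpace ℝ (Fin m),
      ∑ l, ‖mulVecE B (restr (J l) y)‖ ^ 2 ≤ cA * ‖y‖ ^ 2)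
    (hlower : ∀ y : EuclideanSpace ℝ (Fin m), cA * ‖y‖ ^ 2 ≤ ‖mulVecE B y‖ ^ 2)
    (x z : EuclideanSpace ℝ (Fin m)) {s : ℝ} (hs0 : 0 ≤ s) (hs1 : s ≤ 1)
    (hs : s * (σb * q * cA + μ) = q * cA + μ) :
    ∑ l, locG B c₀ w q gbar L σb (J l) x (restr (J l) (s • (z - x))) ≤
      s * objG B c₀ w q gbar z + (1 - s) * objG B c₀ w q gbar x := by
  obtain ⟨u, rfl⟩ : ∃ u, z = x + u := ⟨z - x, by abel⟩
  rw [add_sub_cancel_left, sum_locG_restr B c₀ w q gbar hL hdisj hcover, objG_add, objG]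
  have hg : ∑ i, gbar i (x i + (s • u) i) ≤ s * ∑ i, gbar i (x i + u i)
      + (1 - s) * ∑ i, gbar i (x i) - s * (1 - s) * (μ / 2) * ‖u‖ ^ 2 := by
    rw [EuclideanSpace.real_norm_sq_eq, Finset.mul_sum, Finset.mul_sum, Finset.mul_sum,
      ← Finset.sum_add_distrib, ← Finset.sum_sub_distrib]
    refine Finset.sum_le_sum fun i _ => ?_
    have h := (hgbar i).2 (Set.mem_univ (x i + u i)) (Set.mem_univ (x i)) hs0
      (sub_nonneg.mpr hs1) (by ring)
    have e : s • (x i + u i) + (1 - s) • x i = x i + (s • u) i := by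
      simp only [smul_eq_mul, PiLp.smul_apply]
      ring
    simp only [e, add_sub_cancel_left, Real.norm_eq_abs, sq_abs] at h
    simp only [smul_eq_mul] at h
    linarith
  have hquad : ∑ l, ‖mulVecE B (restr (J l) (s • u))‖ ^ 2 ≤ s ^ 2 * (cA * ‖u‖ ^ 2) := by
    simp only [restr_smul, mulVecE_smul, norm_smul, mul_pow, ← Finset.mul_sum,
      Real.norm_eq_abs, sq_abs]
    exact mul_le_mul_of_nonneg_left (hupper u) (sq_nonneg s)
  have hquad' := mul_le_mul_of_nonneg_left hquad (by positivity : 0 ≤ σb * q / 2)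
  have hlow := mul_le_mul_of_nonneg_left (hlower u) (by positivity : 0 ≤ s * q / 2)
  have hbal : σb * q / 2 * (s ^ 2 * (cA * ‖u‖ ^ 2)) - s * (1 - s) * (μ / 2) * ‖u‖ ^ 2
      = s * q / 2 * (cA * ‖u‖ ^ 2) := by
    linear_combination s * ‖u‖ ^ 2 / 2 * hs
  rw [mulVecE_smul, real_inner_smul_right]
  linarith

/-- One inner CoCoA round contracts the local suboptimality:
`G(d + ∑ ℓ Δ_[ℓ]) − G* ≤ (1 − (1−θ̄)(qc_A + μ)/(σ̄qc_A + μ))(G(d) − G*)`. -/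
theorem stmt_9 {d m L : ℕ} (B : Matrix (Fin d) (Fin m) ℝ) (c₀ : ℝ)
    (w : EuclideanSpace ℝ (Fin d)) (q : ℝ) (hq : 0 < q)
    (gbar : Fin m → ℝ → ℝ) (μ : ℝ) (hμ : 0 ≤ μ)
    (hgbar : ∀ i, StrongConvexOn Set.univ μ (gbar i))
    (J : Fin L → Finset (Fin m))
    (hne : ∀ l, (J l).Nonempty)
    (hdisj : ∀ l l', l ≠ l' → Disjoint (J l) (J l'))
    (hcover : ∀ i, ∃ l, i ∈ J l)
    (σb : ℝ) (hσb : 1 ≤ σb)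
    (hcompat : ∀ y : EuclideanSpace ℝ (Fin m),
      ‖mulVecE B y‖ ^ 2 ≤ σb * ∑ l, ‖mulVecE B (restr (J l) y)‖ ^ 2)
    (cA : ℝ) (hcA : 0 < cA)
    (hupper : ∀ y : EuclideanSpace ℝ (Fin m),
      ∑ l, ‖mulVecE B (restr (J l) y)‖ ^ 2 ≤ cA * ‖y‖ ^ 2)
    (hlower : ∀ y : EuclideanSpace ℝ (Fin m), cA * ‖y‖ ^ 2 ≤ ‖mulVecE B y‖ ^ 2)
    (dstar : EuclideanSpace ℝ (Fin m))
    (hmin : ∀ y : EuclideanSpace ℝ (Fin m), objG B c₀ w q gbar dstar ≤ objG B c₀ w q gbar y)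
    (x : EuclideanSpace ℝ (Fin m)) (θb : ℝ) (hθb : θb ∈ Set.Ioc (0 : ℝ) 1)
    (Δ : Fin L → EuclideanSpace ℝ (Fin m))
    (happrox : ∀ l, IsApproxG B c₀ w q gbar L σb θb (J l) x (Δ l)) :
    objG B c₀ w q gbar (x + ∑ l, Δ l) - objG B c₀ w q gbar dstar ≤
      (1 - (1 - θb) * ((q * cA + μ) / (σb * q * cA + μ))) *
        (objG B c₀ w q gbar x - objG B c₀ w q gbar dstar) := by
  rcases Nat.eq_zero_or_pos L with rfl | hLpos
  · have : IsEmpty (Fin m) := ⟨fun i => (hcover i).choose.elim0⟩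
    rw [Subsingleton.elim (x + ∑ l, Δ l) dstar, Subsingleton.elim x dstar]
    simp
  have hL : L ≠ 0 := hLpos.ne'
  have hden : 0 < σb * q * cA + μ := by positivity
  set s := (q * cA + μ) / (σb * q * cA + μ) with hs
  have hs0 : 0 ≤ s := by positivity
  have hs1 : s ≤ 1 := by
    rw [hs, div_le_one hden, mul_assoc]
    nlinarith [mul_pos hq hcA]
  have hdescent : objG B c₀ w q gbar (x + ∑ l, Δ l)
      ≤ ∑ l, locG B c₀ w q gbar L σb (J l) x (Δ l) := by
    have h := sum_locG_restr B c₀ w q gbar hL hdisj hcover σb x (∑ l, Δ l)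
    rw [Finset.sum_congr rfl fun l _ => by
      rw [restr_sum_eq hdisj (fun l => (happrox l).1) l]] at h
    rw [h, objG_add]
    nlinarith [mul_le_mul_of_nonneg_left (hcompat (∑ l, Δ l)) (half_pos hq).le]
  have hzero : ∑ l, locG B c₀ w q gbar L σb (J l) x 0 = objG B c₀ w q gbar x := by
    have hr : ∀ l, restr (J l) (0 : EuclideanSpace ℝ (Fin m)) = 0 := fun l => by
      ext i
      simp
    have h := sum_locG_restr B c₀ w q gbar hL hdisj hcover σb x 0
    simpa [hr, mulVecE_zero, objG] using h
  have hinf : ∑ l, locGInf B c₀ w q gbar L σb (J l) x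
      ≤ s * objG B c₀ w q gbar dstar + (1 - s) * objG B c₀ w q gbar x := by
    refine le_trans (Finset.sum_le_sum fun l _ => ?_)
      (sum_locG_segment_le B c₀ w hq.le gbar hgbar hL hdisj hcover (by linarith) hupper hlower
        x dstar hs0 hs1 (div_mul_cancel₀ _ hden.ne'))
    refine csInf_le (bddBelow_locG B c₀ w hq.le gbar L hσb (J l) hmin x) ⟨_, ?_, rfl⟩
    intro i hi
    simp [hi]
  have happ := Finset.sum_le_sum fun l (_ : l ∈ Finset.univ) => (happrox l).2
  rw [← Finset.mul_sum, Finset.sum_sub_distrib, Finset.sum_sub_distrib, hzero] at happ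
  have hmul := mul_le_mul_of_nonneg_left hinf (sub_nonneg.mpr hθb.2)
  linarith
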